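/- Fix d ≥ 1, m ≥ 1 and a ≥ 1. Let K be an ad-admissible field (i.e. K* contains the group of roots of unity of order ad). Let W = K^d, μ : W → K the product μ(x^1,...,x^d) = Π_{j=1}^d x^j, V_m = W^m, Q_m(w_1,...,w_m) = Σ_{i=1}^m μ(w_i), and X_m = Q_m^{-1}(0) ⊂ V_m. Then X_m satisfies condition ⋆_a: every weakly polynomial function of degree ≤ a on X_m is the restriction to X_m of a polynomial function of degree ≤ a on V_m. -/

import Mathlib

open MvPolynomial

/-- The Schmidt rank of `P` (as a polynomial of degree `d`) is at least `r`: every way of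
writing `P` as a sum of `m` products of two polynomials of total degree `< d` has `m ≥ r`. -/
def SchmidtRankGE {K : Type*} [CommRing K] {σ : Type*} (d : ℕ)
    (P : MvPolynomial σ K) (r : ℕ) : Prop :=
  ∀ (m : ℕ) (Q R : Fin m → MvPolynomial σ K),
    (∀ i, (Q i).totalDegree < d) → (∀ i, (R i).totalDegree < d) →
    P = ∑ i, Q i * R i → r ≤ m

/-- The symmetric multilinear form `P̃(h₁,…,h_d) = Δ_{h₁} ⋯ Δ_{h_d} P`, where
`Δ_h P(x) = P(x+h) - P(x)`, written as a polynomial in the variables `h₁,…,h_d` via the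
inclusion–exclusion formula `Δ_{h₁} ⋯ Δ_{h_d} P = ∑_{S ⊆ [d]} (-1)^{d-|S|} P(∑_{i∈S} hᵢ)`
(the result of `d` differencings of a polynomial of degree `≤ d` does not depend on the
base point `x`, so we evaluate at `x = 0`). -/
noncomputable def multiDiff {K : Type*} [CommRing K] {σ : Type*} (d : ℕ)
    (P : MvPolynomial σ K) : MvPolynomial (Fin d × σ) K :=
  ∑ S : Finset (Fin d), (-1 : K) ^ (d - S.card) •
    aeval (fun j : σ => ∑ i ∈ S, X (i, j)) P

/-- The non-classical rank (nc-rank) of `P` is at least `r`: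
the Schmidt rank of `P̃` is at least `r`. -/
def ncRankGE {K : Type*} [CommRing K] {σ : Type*} (P : MvPolynomial σ K) (r : ℕ) : Prop :=
  SchmidtRankGE P.totalDegree (multiDiff P.totalDegree P) r

/-- The nc-rank of the collection `P̄` is at least `r`: every nontrivial linear combination
`P_ā = ∑ i, a_i P_i` has nc-rank at least `r`. -/
def ncRankCollGE {K : Type*} [CommRing K] {σ : Type*} {c : ℕ}
    (P : Fin c → MvPolynomial σ K) (r : ℕ) : Prop :=
  ∀ a : Fin c → K, a ≠ 0 → ncRankGE (∑ i, C (a i) * P i) r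

/-- `f` is weakly polynomial of degree `≤ a` on `X ⊆ V = K^σ`: for every affine subspace
`L ⊆ V` with `L ⊆ X`, the restriction of `f` to `L` is (the restriction of) a polynomial
of degree `≤ a`.  (A polynomial of degree `≤ a` on `L` is precisely the restriction to `L`
of a polynomial of degree `≤ a` on `V`: one direction is restriction, the other is
composition with an affine retraction `V → L`.) -/
def WeaklyPolyOn {K : Type*} [Field K] {σ : Type*} (X : Set (σ → K))
    (f : (σ → K) → K) (a : ℕ) : Prop :=
  ∀ L : AffineSubspace K (σ → K), (L : Set (σ → K)) ⊆ X →
    ∃ g : MvPolynomial σ K, g.totalDegree ≤ a ∧ ∀ x ∈ L, f x = eval x g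

/-- `X ⊆ V = K^σ` satisfies condition `⋆_a`: every weakly polynomial function of degree
`≤ a` on `X` is the restriction to `X` of a polynomial of degree `≤ a` on `V`. -/
def StarCondition {K : Type*} [Field K] {σ : Type*} (X : Set (σ → K)) (a : ℕ) : Prop :=
  ∀ f : (σ → K) → K, WeaklyPolyOn X f a →
    ∃ g : MvPolynomial σ K, g.totalDegree ≤ a ∧ ∀ x ∈ X, f x = eval x g


def XX (K : Type*) [Field K] (m d : ℕ) : Set (Fin m × Fin d → K) :=
  {x | ∑ i, ∏ j, x (i, j) = 0}

def scl {K : Type*} [Field K] {m d : ℕ} (J : Fin m → Fin d) (t : K) (x : Fin m × Fin d → K) :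
    Fin m × Fin d → K := fun p => if J p.1 = p.2 then t * x p else x p

def LP {K : Type*} [Field K] {σ : Type*} (X : Set (σ → K)) (f : (σ → K) → K) (a : ℕ) : Prop :=
  ∀ b w : σ → K, (∀ t : K, (fun p => b p + t * w p) ∈ X) →
    ∃ q : Polynomial K, q.natDegree ≤ a ∧ ∀ t, f (fun p => b p + t * w p) = q.eval t

def WP {K : Type*} [Field K] {σ : Type*} (X : Set (σ → K))
    (f : (σ → K) → K) (a : ℕ) : Prop :=
  ∀ L : AffineSubspace K (σ → K), (L : Set (σ → K)) ⊆ X →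
    ∃ g : MvPolynomial σ K, g.totalDegree ≤ a ∧ ∀ x ∈ L, f x = eval x g

def ExtP {K : Type*} [Field K] {σ : Type*} (X : Set (σ → K))
    (f : (σ → K) → K) (a : ℕ) : Prop :=
  ∃ g : MvPolynomial σ K, g.totalDegree ≤ a ∧ ∀ x ∈ X, f x = eval x g

def Hom {K : Type*} [Field K] {m d : ℕ} (f : (Fin m × Fin d → K) → K) (J : Fin m → Fin d)
    (s : ℕ) : Prop := ∀ x ∈ XX K m d, ∀ t : K, f (scl J t x) = t ^ s * f x

section
variable {K : Type*} [Field K] {m d : ℕ}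

lemma prod_scl (J : Fin m → Fin d) (t : K) (x : Fin m × Fin d → K) (i : Fin m) :
    ∏ j, scl J t x (i, j) = t * ∏ j, x (i, j) := by
  have : ∀ j, scl J t x (i, j) = (if J i = j then t else 1) * x (i, j) := by
    intro j; simp only [scl]; split_ifs <;> simp
  simp only [this, Finset.prod_mul_distrib, Finset.prod_ite_eq, Finset.mem_univ, if_true]

lemma scl_mem (J : Fin m → Fin d) (t : K) {x : Fin m × Fin d → K} (hx : x ∈ XX K m d) :
    scl J t x ∈ XX K m d := by
  simp only [XX, Set.mem_ofPred_eq, prod_scl, ← Finset.mul_sum] at *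
  rw [hx, mul_zero]

lemma scl_comm (J J' : Fin m → Fin d) (t t' : K) (x : Fin m × Fin d → K) :
    scl J t (scl J' t' x) = scl J' t' (scl J t x) := by
  funext p; simp only [scl]; split_ifs <;> ring

lemma natDegree_aeval_le {σ : Type*} (g : MvPolynomial σ K) (l : σ → Polynomial K)
    (hl : ∀ i, (l i).natDegree ≤ 1) : (aeval l g).natDegree ≤ g.totalDegree := by
  rw [aeval_def, eval₂_eq]
  refine Polynomial.natDegree_sum_le_of_forall_le _ _ ?_
  intro e he
  refine (Polynomial.natDegree_C_mul_le _ _).trans ?_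
  refine (Polynomial.natDegree_prod_le _ _).trans ?_
  refine le_trans ?_ (le_totalDegree he)
  refine Finset.sum_le_sum fun i _ => ?_
  refine Polynomial.natDegree_pow_le.trans ?_
  calc _ ≤ e i * 1 := Nat.mul_le_mul_left _ (hl i)
    _ = _ := mul_one _

lemma totalDegree_aeval_le' {σ τ : Type*} (g : MvPolynomial σ K) (l : σ → MvPolynomial τ K)
    (hl : ∀ i, (l i).totalDegree ≤ 1) : (aeval l g).totalDegree ≤ g.totalDegree := by
  rw [aeval_def, eval₂_eq]
  refine totalDegree_finsetSum_le ?_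
  intro e he
  refine (totalDegree_mul _ _).trans ?_
  rw [algebraMap_eq, totalDegree_C, zero_add]
  refine (totalDegree_finsetProd _ _).trans ?_
  refine le_trans ?_ (le_totalDegree he)
  refine Finset.sum_le_sum fun i _ => ?_
  refine (totalDegree_pow _ _).trans ?_
  calc _ ≤ e i * 1 := Nat.mul_le_mul_left _ (hl i)
    _ = _ := mul_one _

lemma WP.lp {σ : Type*} {X : Set (σ → K)} {f : (σ → K) → K} {a : ℕ} (h : WP X f a) :
    LP X f a := by
  intro b w hbw
  obtain ⟨g, hg, hfg⟩ := h (AffineSubspace.mk' b (Submodule.span K {w})) (by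
    intro x hx
    rw [SetLike.mem_coe, AffineSubspace.mem_mk', Submodule.mem_span_singleton] at hx
    obtain ⟨t, ht⟩ := hx
    convert hbw t using 1
    funext p
    have := congrFun ht p
    simp only [Pi.smul_apply, smul_eq_mul, vsub_eq_sub, Pi.sub_apply] at this
    rw [this]; ring)
  refine ⟨aeval (fun p => Polynomial.C (b p) + Polynomial.X * Polynomial.C (w p)) g,
    (natDegree_aeval_le _ _ ?_).trans hg, ?_⟩
  · intro i
    compute_degree
  · intro t
    rw [hfg]
    · rw [← Polynomial.coe_evalRingHom, ← RingHom.coe_coe (aeval _), ← RingHom.comp_apply]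
      congr 1
      apply MvPolynomial.ringHom_ext
      · intros; simp
      · intro p; simp; ring
    · rw [AffineSubspace.mem_mk', Submodule.mem_span_singleton]
      exact ⟨t, by funext p; simp⟩

lemma WP.sub_poly {σ : Type*} {X : Set (σ → K)} {f : (σ → K) → K} {a : ℕ} (h : WP X f a)
    (g : MvPolynomial σ K) (hg : g.totalDegree ≤ a) : WP X (fun x => f x - eval x g) a := by
  intro L hL
  obtain ⟨g', h1, h2⟩ := h L hL
  refine ⟨g' - g, (totalDegree_sub _ _).trans (max_le h1 hg), fun x hx => ?_⟩
  simp [h2 x hx]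

lemma WP.lincomb {σ ι : Type*} {X : Set (σ → K)} (S : Finset ι) (c : ι → K)
    (F : ι → (σ → K) → K) {a : ℕ} (h : ∀ i ∈ S, WP X (F i) a) :
    WP X (fun x => ∑ i ∈ S, F i x * c i) a := by
  classical
  intro L hL
  choose! g h1 h2 using fun i hi => h i hi L hL
  refine ⟨∑ i ∈ S, g i * C (c i), totalDegree_finsetSum_le fun i hi => ?_, fun x hx => ?_⟩
  · refine (totalDegree_mul _ _).trans ?_
    rw [totalDegree_C]; exact h1 i hi
  · rw [map_sum]
    refine Finset.sum_congr rfl fun i hi => ?_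
    simp [h2 i hi x hx]

lemma WP.scl {f : (Fin m × Fin d → K) → K} {a : ℕ} (h : WP (XX K m d) f a)
    (J : Fin m → Fin d) (t : K) : WP (XX K m d) (fun x => f (scl J t x)) a := by
  intro L hL
  let A : (Fin m × Fin d → K) →ₗ[K] (Fin m × Fin d → K) :=
    { toFun := _root_.scl J t
      map_add' := by intro x y; funext p; simp only [_root_.scl, Pi.add_apply]; split_ifs <;> ring
      map_smul' := by
        intro c x; funext p
        simp only [_root_.scl, Pi.smul_apply, smul_eq_mul, RingHom.id_apply]; split_ifs <;> ring }
  obtain ⟨g, h1, h2⟩ := h (L.map A.toAffineMap) (by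
    rintro _ ⟨x, hx, rfl⟩
    exact scl_mem J t (hL hx))
  refine ⟨aeval (fun p => if J p.1 = p.2 then C t * X p else X p) g,
    (totalDegree_aeval_le' _ _ ?_).trans h1, ?_⟩
  · intro p
    split_ifs
    · refine (totalDegree_mul _ _).trans ?_
      simp [totalDegree_C, totalDegree_X]
    · simp [totalDegree_X]
  · intro x hx
    have : f (_root_.scl J t x) = eval (_root_.scl J t x) g :=
      h2 (_root_.scl J t x) ⟨x, hx, rfl⟩
    simp only [this]
    rw [← RingHom.coe_coe (aeval _), ← RingHom.comp_apply]
    congr 1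
    apply MvPolynomial.ringHom_ext
    · intros; simp
    · intro p; simp only [eval_X, _root_.scl, RingHom.comp_apply, RingHom.coe_coe, aeval_X]
      split_ifs <;> simp

/-- coefficient extraction: -/
lemma scl_poly {f : (Fin m × Fin d → K) → K} {a : ℕ} (h : LP (XX K m d) f a)
    (J : Fin m → Fin d) {x : Fin m × Fin d → K} (hx : x ∈ XX K m d) :
    ∃ q : Polynomial K, q.natDegree ≤ a ∧ ∀ t, f (scl J t x) = q.eval t := by
  have e : ∀ t, scl J t x = fun p => scl J 0 x p + t * (if J p.1 = p.2 then x p else 0) := by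
    intro t; funext p; simp only [scl]; split_ifs <;> simp
  obtain ⟨q, h1, h2⟩ := h (scl J 0 x) (fun p => if J p.1 = p.2 then x p else 0) (by
    intro t; rw [← e]; exact scl_mem J t hx)
  exact ⟨q, h1, fun t => by rw [e, h2]⟩

lemma decomp_step {f : (Fin m × Fin d → K) → K} {a : ℕ} (h : WP (XX K m d) f a)
    (S : Finset K) (hS : a < S.card) (J : Fin m → Fin d) :
    ∃ F : ℕ → (Fin m × Fin d → K) → K,
      (∀ s, WP (XX K m d) (F s) a) ∧ (∀ s, Hom (F s) J s) ∧
      (∀ J' s', Hom f J' s' → ∀ s, Hom (F s) J' s') ∧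
      ∀ x ∈ XX K m d, f x = ∑ s ∈ Finset.range (a + 1), F s x := by
  classical
  let c : ℕ → K → K := fun s k => (Lagrange.basis S id k).coeff s
  have hc : ∀ q : Polynomial K, q.natDegree ≤ a → ∀ s,
      q.coeff s = ∑ k ∈ S, q.eval k * c s k := by
    intro q hq s
    have : q = Lagrange.interpolate S id (fun k => q.eval k) := by
      apply Lagrange.eq_interpolate_of_eval_eq
      · exact Function.injective_id.injOn
      · refine lt_of_le_of_lt Polynomial.degree_le_natDegree ?_
        exact_mod_cast lt_of_le_of_lt hq hS
      · intros; rfl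
    conv_lhs => rw [this, Lagrange.interpolate_apply, Polynomial.finsetSum_coeff]
    simp [c, Polynomial.coeff_C_mul]
  refine ⟨fun s x => ∑ k ∈ S, f (scl J k x) * c s k, ?_, ?_, ?_, ?_⟩
  · intro s
    exact WP.lincomb S (c s) (fun k x => f (scl J k x)) (fun k _ => h.scl J k)
  · intro s x hx t
    obtain ⟨q, h1, h2⟩ := scl_poly h.lp J hx
    have e : ∀ k, scl J k (scl J t x) = scl J (t * k) x := by
      intro k; funext p; simp only [scl]; split_ifs <;> ring
    have e2 := hc (q.comp (Polynomial.C t * Polynomial.X)) (by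
      refine Polynomial.natDegree_comp_le.trans ?_
      have h1' : (Polynomial.C t * Polynomial.X).natDegree ≤ 1 := by compute_degree
      exact (Nat.mul_le_mul h1 h1').trans (by simp)) s
    simp only [e, h2, ← hc q h1]
    simp only [Polynomial.eval_comp, Polynomial.eval_mul, Polynomial.eval_C,
      Polynomial.eval_X] at e2
    rw [← e2, Polynomial.comp_C_mul_X_coeff]; ring
  · intro J' s' hf s x hx t
    simp only [Finset.mul_sum]
    refine Finset.sum_congr rfl fun k _ => ?_
    rw [scl_comm, hf _ (scl_mem _ _ hx)]; ring
  · intro x hx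
    obtain ⟨q, h1, h2⟩ := scl_poly h.lp J hx
    simp only [h2, ← hc q h1]
    have : f x = q.eval 1 := by
      rw [← h2]; congr 1; funext p; simp [scl]
    rw [this, Polynomial.eval_eq_sum_range' (Nat.lt_succ_of_le h1)]
    simp

lemma decomp {a : ℕ} (S : Finset K) (hS : a < S.card)
    (H : ∀ f : (Fin m × Fin d → K) → K, WP (XX K m d) f a → (∀ J, ∃ s ≤ a, Hom f J s) →
      ExtP (XX K m d) f a) :
    ∀ f : (Fin m × Fin d → K) → K, WP (XX K m d) f a → ExtP (XX K m d) f a := by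
  classical
  suffices ∀ T : Finset (Fin m → Fin d), ∀ f : (Fin m × Fin d → K) → K, WP (XX K m d) f a →
      (∀ J ∉ T, ∃ s ≤ a, Hom f J s) → ExtP (XX K m d) f a by
    intro f hf
    exact this Finset.univ f hf (by simp)
  intro T
  induction T using Finset.induction_on with
  | empty => intro f hf h; exact H f hf (fun J => h J (by simp))
  | insert J T hJ ih =>
    intro f hf h
    obtain ⟨F, h1, h2, h3, h4⟩ := decomp_step hf S hS J
    have : ∀ s ∈ Finset.range (a + 1), ExtP (XX K m d) (F s) a := by
      intro s hs
      refine ih (F s) (h1 s) ?_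
      intro J' hJ'
      by_cases e : J' = J
      · subst e; exact ⟨s, by simpa [Nat.lt_succ_iff] using hs, h2 s⟩
      · obtain ⟨s', ha, hs'⟩ := h J' (by simp [e, hJ'])
        exact ⟨s', ha, h3 _ _ hs' s⟩
    choose! g hg1 hg2 using this
    refine ⟨∑ s ∈ Finset.range (a + 1), g s, totalDegree_finsetSum_le hg1, ?_⟩
    intro x hx
    rw [h4 x hx, map_sum]
    exact Finset.sum_congr rfl fun s hs => hg2 s hs x hx

end


section
variable {K : Type*} [Field K] {m d : ℕ}

/-- Two polynomial functions of degree at most `N` agreeing on more than `N` points. -/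
lemma poly_eq (S : Finset K) (N : ℕ) (hS : N < S.card) (p q : Polynomial K)
    (hp : p.natDegree ≤ N) (hq : q.natDegree ≤ N) (h : ∀ t ∈ S, p.eval t = q.eval t) : p = q := by
  rw [← sub_eq_zero]
  refine Polynomial.eq_zero_of_natDegree_lt_card_of_eval_eq_zero' _ S ?_ ?_
  · intro t ht; simp [h t ht]
  · exact lt_of_le_of_lt ((Polynomial.natDegree_sub_le _ _).trans (max_le hp hq)) hS

lemma pow_deg (S : Finset K) (a N : ℕ) (hS : N < S.card) (haS : a < S.card) (c : K) (hc : c ≠ 0)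
    (q : Polynomial K)
    (hq : q.natDegree ≤ a) (h : ∀ t, c * t ^ N = q.eval t) : N ≤ a := by
  have := poly_eq S (max a N) (max_lt haS hS) (Polynomial.C c * Polynomial.X ^ N) q
    ((Polynomial.natDegree_C_mul_X_pow_le _ _).trans (le_max_right _ _))
    (hq.trans (le_max_left _ _))
    (by intro t _; simp [h])
  rw [← this, Polynomial.natDegree_C_mul_X_pow _ _ hc] at hq
  exact hq

def InU (J : Fin m → Fin d) (x : Fin m × Fin d → K) : Prop := ∀ p, p.2 ≠ J p.1 → x p ≠ 0

def sig (J : Fin m → Fin d) (y : Fin m → K) : Fin m × Fin d → K :=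
  fun p => if J p.1 = p.2 then y p.1 else 1

lemma sig_prod (J : Fin m → Fin d) (y : Fin m → K) (i : Fin m) :
    ∏ j, sig J y (i, j) = y i := by
  simp [sig, Finset.prod_ite_eq]

lemma sig_mem (J : Fin m → Fin d) {y : Fin m → K} (hy : ∑ i, y i = 0) :
    sig J y ∈ XX K m d := by
  simp only [XX, Set.mem_ofPred_eq, sig_prod, hy]

/-- Multiply coordinate `p` by `t` and divide the distinguished coordinate in the same row. -/
def swp (J : Fin m → Fin d) (p : Fin m × Fin d) (t : K) (x : Fin m × Fin d → K) :
    Fin m × Fin d → K := scl (Function.update J p.1 p.2) t (scl J t⁻¹ x)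

lemma swp_mem (J : Fin m → Fin d) (p : Fin m × Fin d) (t : K) {x : Fin m × Fin d → K}
    (hx : x ∈ XX K m d) : swp J p t x ∈ XX K m d := scl_mem _ _ (scl_mem _ _ hx)

lemma swp_prod (J : Fin m → Fin d) (p : Fin m × Fin d) {t : K} (ht : t ≠ 0)
    (x : Fin m × Fin d → K) (i : Fin m) : ∏ j, swp J p t x (i, j) = ∏ j, x (i, j) := by
  rw [swp, prod_scl, prod_scl, ← mul_assoc, mul_inv_cancel₀ ht, one_mul]

lemma swp_self (J : Fin m → Fin d) (p : Fin m × Fin d) (hp : p.2 ≠ J p.1) (t : K)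
    (x : Fin m × Fin d → K) : swp J p t x p = t * x p := by
  simp [swp, scl, hp.symm]

lemma swp_other (J : Fin m → Fin d) (p q : Fin m × Fin d) (hq : q.2 ≠ J q.1) (hpq : q ≠ p) (t : K)
    (x : Fin m × Fin d → K) : swp J p t x q = x q := by
  obtain ⟨i, j⟩ := p
  obtain ⟨i', j'⟩ := q
  simp only [swp, scl, hq.symm, if_false]
  by_cases h : i' = i
  · subst h
    simp only [Function.update_self]
    rw [if_neg]; rintro rfl; exact hpq rfl
  · rw [Function.update_of_ne h, if_neg hq.symm]

lemma hom_swp {f : (Fin m × Fin d → K) → K} {s : (Fin m → Fin d) → ℕ}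
    (hs : ∀ J, Hom f J (s J)) (J : Fin m → Fin d) (hJ : ∀ J', s J ≤ s J')
    (p : Fin m × Fin d) {t : K} (ht : t ≠ 0) {x : Fin m × Fin d → K} (hx : x ∈ XX K m d) :
    f (swp J p t x) = t ^ (s (Function.update J p.1 p.2) - s J) * f x := by
  rw [swp, hs _ _ (scl_mem _ _ hx), hs _ _ hx, ← mul_assoc, inv_pow, pow_sub₀ _ ht (hJ _)]

open Classical in
/-- Formula for `f` on the chart attached to `J`. -/
lemma chart {f : (Fin m × Fin d → K) → K} {s : (Fin m → Fin d) → ℕ}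
    (hs : ∀ J, Hom f J (s J)) (J : Fin m → Fin d) (hJ : ∀ J', s J ≤ s J') :
    ∀ n : ℕ, ∀ x ∈ XX K m d, InU J x →
      (Finset.univ.filter fun p : Fin m × Fin d => p.2 ≠ J p.1 ∧ x p ≠ 1).card = n →
      f x = (∏ p, x p ^ (s (Function.update J p.1 p.2) - s J)) *
        f (sig J fun i => ∏ j, x (i, j)) := by
  intro n
  induction n with
  | zero =>
    intro x hx hU h
    rw [Finset.card_eq_zero, Finset.filter_eq_empty_iff] at h
    have h1 : ∀ p : Fin m × Fin d, p.2 ≠ J p.1 → x p = 1 := by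
      intro p hp; by_contra h2; exact h (Finset.mem_univ p) ⟨hp, h2⟩
    have h2 : ∏ p, x p ^ (s (Function.update J p.1 p.2) - s J) = 1 := by
      refine Finset.prod_eq_one fun p _ => ?_
      by_cases hp : p.2 = J p.1
      · rw [hp]; simp
      · rw [h1 p hp, one_pow]
    have h3 : (sig J fun i => ∏ j, x (i, j)) = x := by
      funext p
      obtain ⟨i, j⟩ := p
      simp only [sig]
      split_ifs with h4
      · subst h4
        refine Finset.prod_eq_single _ ?_ (by simp)
        intro j _ hj
        exact h1 (i, j) hj
      · exact (h1 (i, j) (fun h => h4 h.symm)).symm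
    rw [h2, h3, one_mul]
  | succ n ih =>
    intro x hx hU h
    obtain ⟨p, hp⟩ : (Finset.univ.filter fun p : Fin m × Fin d =>
      p.2 ≠ J p.1 ∧ x p ≠ 1).Nonempty := by rw [← Finset.card_pos, h]; omega
    have hp' := (Finset.mem_filter.1 hp).2
    have hne := hU p hp'.1
    have hne' := inv_ne_zero hne
    set x' := swp J p (x p)⁻¹ x with hx'
    have hself : x' p = 1 := by rw [hx', swp_self _ _ hp'.1, inv_mul_cancel₀ hne]
    have hoth : ∀ q, q.2 ≠ J q.1 → q ≠ p → x' q = x q := fun q hq hqp => swp_other _ _ _ hq hqp _ _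
    have := ih x' (swp_mem _ _ _ hx) ?_ ?_
    · rw [hx', hom_swp hs J hJ p hne' hx] at this
      rw [← hx'] at this
      have e1 : (∏ q, x q ^ (s (Function.update J q.1 q.2) - s J)) =
          (∏ q, x' q ^ (s (Function.update J q.1 q.2) - s J)) *
            x p ^ (s (Function.update J p.1 p.2) - s J) := by
        have : ∀ q, x q ^ (s (Function.update J q.1 q.2) - s J) =
          x' q ^ (s (Function.update J q.1 q.2) - s J) *
            (if q = p then x p ^ (s (Function.update J p.1 p.2) - s J) else 1) := by
          intro q
          by_cases hqp : q = p
          · subst hqp; simp [hself]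
          · rw [if_neg hqp, mul_one]
            by_cases hq : q.2 = J q.1
            · rw [hq]; simp
            · rw [hoth q hq hqp]
        rw [Finset.prod_congr rfl fun q _ => this q, Finset.prod_mul_distrib]
        simp
      have e2 : (fun i => ∏ j, x' (i, j)) = fun i => ∏ j, x (i, j) := by
        funext i; exact swp_prod _ _ hne' _ _
      rw [e2] at this
      rw [e1, mul_right_comm, ← this, inv_pow]
      have : x p ^ (s (Function.update J p.1 p.2) - s J) ≠ 0 := pow_ne_zero _ hne
      field_simp
    · intro q hq
      by_cases hqp : q = p
      · subst hqp; rw [hself]; exact one_ne_zero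
      · rw [hoth q hq hqp]; exact hU q hq
    · have : (Finset.univ.filter fun q : Fin m × Fin d => q.2 ≠ J q.1 ∧ x' q ≠ 1) =
        (Finset.univ.filter fun q : Fin m × Fin d => q.2 ≠ J q.1 ∧ x q ≠ 1).erase p := by
        ext q
        simp only [Finset.mem_filter, Finset.mem_univ, true_and, Finset.mem_erase]
        by_cases hqp : q = p
        · subst hqp; simp [hself]
        · constructor
          · rintro ⟨h1, h2⟩; rw [hoth q h1 hqp] at h2; exact ⟨hqp, h1, h2⟩
          · rintro ⟨_, h1, h2⟩; rw [← hoth q h1 hqp] at h2; exact ⟨h1, h2⟩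
      rw [this, Finset.card_erase_of_mem hp, h]; rfl

lemma hom_eval {σ : Type*} {P : MvPolynomial σ K} {s : ℕ} (hP : P.IsHomogeneous s) (t : K)
    (y : σ → K) : eval (fun i => t * y i) P = t ^ s * eval y P := by
  rw [eval_eq, eval_eq, Finset.mul_sum]
  refine Finset.sum_congr rfl fun e he => ?_
  have h1 := hP (mem_support_iff.1 he)
  have h2 : ∑ i ∈ e.support, e i = s := by
    rw [← h1, Finsupp.weight_apply, Finsupp.sum]; simp
  simp only [mul_pow, Finset.prod_mul_distrib, Finset.prod_pow_eq_pow_sum, h2]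
  ring

/-- Polynomiality of `f` along the section `sig`. -/
lemma sig_poly {f : (Fin m × Fin d → K) → K} {a : ℕ} (h : WP (XX K m d) f a)
    (S : Finset K) (hS : a < S.card) (J : Fin m → Fin d) (k : ℕ) (hka : k ≤ a)
    (hk : Hom f J k) :
    ∃ P : MvPolynomial (Fin m) K, P.IsHomogeneous k ∧
      ∀ y : Fin m → K, ∑ i, y i = 0 → f (sig J y) = eval y P := by
  let A : (Fin m → K) →ₗ[K] (Fin m × Fin d → K) :=
    { toFun := fun y p => if J p.1 = p.2 then y p.1 else 0
      map_add' := by intro x y; funext p; simp only [Pi.add_apply]; split_ifs <;> ring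
      map_smul' := by
        intro c x; funext p
        simp only [Pi.smul_apply, smul_eq_mul, RingHom.id_apply]; split_ifs <;> ring }
  let H : Submodule K (Fin m → K) := LinearMap.ker (∑ i, LinearMap.proj i)
  have hH : ∀ y, y ∈ H ↔ ∑ i, y i = 0 := by
    intro y; simp [H, LinearMap.mem_ker]
  have hsig : ∀ y, sig J y = A y + sig J 0 := by
    intro y; funext p; simp only [sig, A, Pi.add_apply, LinearMap.coe_mk, AddHom.coe_mk]
    split_ifs <;> simp
  obtain ⟨G, hG, hfG⟩ := h (AffineSubspace.mk' (sig J 0) (H.map A)) (by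
    intro x hx
    rw [SetLike.mem_coe, AffineSubspace.mem_mk', Submodule.mem_map] at hx
    obtain ⟨y, hy, he⟩ := hx
    have : x = sig J y := by rw [hsig, he]; simp
    rw [this]; exact sig_mem J ((hH y).1 hy))
  let l : Fin m × Fin d → MvPolynomial (Fin m) K := fun p => if J p.1 = p.2 then X p.1 else 1
  let Q : MvPolynomial (Fin m) K := aeval l G
  have hQ : Q.totalDegree ≤ a := by
    refine (totalDegree_aeval_le' G l ?_).trans hG
    intro p; simp only [l]; split_ifs <;> simp
  have hfQ : ∀ y : Fin m → K, ∑ i, y i = 0 → f (sig J y) = eval y Q := by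
    intro y hy
    rw [hfG]
    · simp only [Q]
      rw [← RingHom.coe_coe (aeval _), ← RingHom.comp_apply]
      congr 1
      apply MvPolynomial.ringHom_ext
      · intros; simp
      · intro p; simp only [eval_X, sig, l, RingHom.comp_apply, RingHom.coe_coe, aeval_X]
        split_ifs <;> simp
    · rw [AffineSubspace.mem_mk', Submodule.mem_map]
      exact ⟨y, (hH y).2 hy, by rw [hsig y]; simp⟩
  refine ⟨homogeneousComponent k Q, homogeneousComponent_isHomogeneous k Q, ?_⟩
  intro y hy
  have hcomp : ∀ t, eval (fun i => t * y i) Q = ∑ s ∈ Finset.range (a + 1),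
      t ^ s * eval y (homogeneousComponent s Q) := by
    intro t
    conv_lhs => rw [← sum_homogeneousComponent Q, map_sum]
    have e : ∀ s, eval (fun i => t * y i) (homogeneousComponent s Q) =
        t ^ s * eval y (homogeneousComponent s Q) := by
      intro s
      exact hom_eval (homogeneousComponent_isHomogeneous s Q) t y
    simp only [e]
    refine Finset.sum_subset ?_ ?_
    · intro s; simp only [Finset.mem_range]; omega
    · intro s _ hs
      rw [homogeneousComponent_eq_zero, map_zero, mul_zero]
      simp only [Finset.mem_range] at hs
      omega
  have := poly_eq S a hS (∑ s ∈ Finset.range (a + 1),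
    Polynomial.C (eval y (homogeneousComponent s Q)) * Polynomial.X ^ s)
    (Polynomial.C (eval y Q) * Polynomial.X ^ k) ?_ ?_ ?_
  · have := congrArg (fun p => Polynomial.coeff p k) this
    simp only [Polynomial.finsetSum_coeff, Polynomial.coeff_C_mul_X_pow,
      Finset.sum_ite_eq, Finset.mem_range, if_true] at this
    rw [if_pos (by omega)] at this
    rw [hfQ y hy, this]
  · refine Polynomial.natDegree_sum_le_of_forall_le _ _ ?_
    intro s hs
    refine (Polynomial.natDegree_C_mul_X_pow_le _ _).trans ?_
    simp only [Finset.mem_range] at hs; omega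
  · exact (Polynomial.natDegree_C_mul_X_pow_le _ _).trans hka
  · intro t _
    have e1 : sig J (fun i => t * y i) = scl J t (sig J y) := by
      funext p; simp only [sig, scl]; split_ifs <;> rfl
    have e2 := hfQ (fun i => t * y i) (by rw [← Finset.mul_sum, hy, mul_zero])
    rw [e1, hk _ (sig_mem J hy), hcomp, hfQ y hy] at e2
    simp only [Polynomial.eval_finsetSum, Polynomial.eval_mul, Polynomial.eval_C,
      Polynomial.eval_pow, Polynomial.eval_X]
    rw [mul_comm _ (t ^ k), e2]
    exact Finset.sum_congr rfl fun _ _ => mul_comm _ _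
end


section
variable {K : Type*} [Field K] {m d : ℕ}

lemma mem_update_row (x : Fin m × Fin d → K) (i : Fin m) (j : Fin d) :
    ∏ j', x (i, j') = x (i, j) * ∏ j' ∈ Finset.univ.erase j, x (i, j') :=
  (Finset.mul_prod_erase _ _ (Finset.mem_univ j)).symm

open Classical in
lemma spread {F : (Fin m × Fin d → K) → K} {a : ℕ} (hF : LP (XX K m d) F a)
    (S : Finset K) (hS : a < S.card) (h0 : (0 : K) ∉ S) (J : Fin m → Fin d)
    (hU : ∀ x ∈ XX K m d, InU J x → F x = 0) :
    ∀ n : ℕ, ∀ x ∈ XX K m d,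
      (Finset.univ.filter fun p : Fin m × Fin d => p.2 ≠ J p.1 ∧ x p = 0).card = n →
      (2 ≤ m ∨ ∀ i, x (i, J i) = 0) → F x = 0 := by
  intro n
  induction n using Nat.strong_induction_on with
  | _ n ih =>
  intro x hx hn hm
  -- reduction to a line
  have key : ∀ (p : Fin m × Fin d) (w : Fin m × Fin d → K), p.2 ≠ J p.1 → x p = 0 →
      (∀ t : K, (fun q => x q + t * w q) ∈ XX K m d) → w p ≠ 0 →
      (∀ q, q.2 ≠ J q.1 → x q ≠ 0 → w q = 0) →
      (2 ≤ m ∨ ∀ i, w (i, J i) = 0) → F x = 0 := by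
    intro p w hp hxp hX hw hw' hm'
    obtain ⟨q, h1, h2⟩ := hF x w hX
    have hq : q = 0 := by
      refine poly_eq S a hS q 0 h1 (by simp) ?_
      intro t ht
      have ht0 : t ≠ 0 := fun h => h0 (h ▸ ht)
      rw [← h2, Polynomial.eval_zero]
      refine ih _ ?_ _ (hX t) rfl ?_
      · rw [← hn]
        refine Finset.card_lt_card ?_
        rw [Finset.ssubset_iff_of_subset]
        · refine ⟨p, by simp [hp, hxp], ?_⟩
          simp [hxp, ht0, hw]
        · intro r
          simp only [Finset.mem_filter, Finset.mem_univ, true_and]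
          rintro ⟨h3, h4⟩
          refine ⟨h3, ?_⟩
          by_contra h5
          rw [hw' r h3 h5] at h4
          simp [h5] at h4
      · by_cases h2m : 2 ≤ m
        · exact Or.inl h2m
        · refine Or.inr fun i => ?_
          simp only [h2m, false_or] at hm hm'
          simp [hm i, hm' i]
    have := h2 0
    rw [hq] at this
    simpa using this
  by_cases hbad : ∃ p : Fin m × Fin d, p.2 ≠ J p.1 ∧ x p = 0
  swap
  · push Not at hbad
    exact hU x hx hbad
  by_cases hcase : ∃ p : Fin m × Fin d, p.2 ≠ J p.1 ∧ x p = 0 ∧ ∃ j, j ≠ p.2 ∧ x (p.1, j) = 0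
  · obtain ⟨p, hp, hxp, j, hj, hxj⟩ := hcase
    refine key p (fun q => if q = p then 1 else 0) hp hxp ?_ (by simp) ?_ ?_
    · intro t
      have : ∀ i, ∏ j, (x (i, j) + t * (if (i, j) = p then 1 else 0)) = ∏ j, x (i, j) := by
        intro i
        by_cases hi : i = p.1
        · rw [Finset.prod_eq_zero (Finset.mem_univ j), Finset.prod_eq_zero (Finset.mem_univ j)]
          · rw [hi]; exact hxj
          · rw [hi, hxj, if_neg, mul_zero, add_zero]
            intro h; exact hj (congrArg Prod.snd h)
        · refine Finset.prod_congr rfl fun j' _ => ?_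
          rw [if_neg, mul_zero, add_zero]
          intro h; exact hi (congrArg Prod.fst h)
      simp only [XX, Set.mem_ofPred_eq, this]
      exact hx
    · intro q hq hxq
      rw [if_neg]; rintro rfl; exact hxq hxp
    · right
      intro i
      rw [if_neg]; intro h; rw [← h] at hp; exact hp rfl
  · obtain ⟨p, hp, hxp⟩ := hbad
    have hp1 : ∀ j, j ≠ p.2 → x (p.1, j) ≠ 0 := fun j hj h => hcase ⟨p, hp, hxp, j, hj, h⟩
    have h2m : 2 ≤ m := by
      rcases hm with h | h
      · exact h
      · exact absurd (h p.1) (hp1 _ hp.symm)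
    obtain ⟨i', hi'⟩ : ∃ i' : Fin m, i' ≠ p.1 := by
      haveI : Nontrivial (Fin m) := Fin.nontrivial_iff_two_le.2 h2m
      exact exists_ne _
    obtain ⟨j', hj', hj''⟩ : ∃ j', (∀ j, j ≠ j' → x (i', j) ≠ 0) ∧ (j' ≠ J i' → x (i', j') = 0) := by
      by_cases h : ∃ j', x (i', j') = 0
      · obtain ⟨j', h1⟩ := h
        refine ⟨j', ?_, fun _ => h1⟩
        intro j hj h2
        by_cases h3 : j' = J i'
        · exact hcase ⟨(i', j), by rw [← h3]; exact hj, h2, j', hj.symm, h1⟩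
        · exact hcase ⟨(i', j'), h3, h1, j, hj, h2⟩
      · push Not at h
        exact ⟨J i', fun j _ => h j, fun h => absurd rfl h⟩
    obtain ⟨i, j⟩ := p
    simp only at hp hxp hp1 hi'
    set c := ∏ j2 ∈ Finset.univ.erase j, x (i, j2) with hc
    set c' := ∏ j2 ∈ Finset.univ.erase j', x (i', j2) with hc'
    have hc0' : c' ≠ 0 := Finset.prod_ne_zero_iff.2 fun j2 h => hj' j2 (Finset.ne_of_mem_erase h)
    refine key (i, j) (fun q => if q = (i, j) then c' else if q = (i', j') then -c else 0)
      hp hxp ?_ (by simpa using hc0') ?_ (Or.inl h2m)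
    · intro t
      have e : ∀ i2, ∏ j2, (x (i2, j2) + t * (if (i2, j2) = (i, j) then c'
          else if (i2, j2) = (i', j') then -c else 0)) = ∏ j2, x (i2, j2) +
          ((if i2 = i then t * c * c' else 0) + (if i2 = i' then - (t * c * c') else 0)) := by
        intro i2
        by_cases h1 : i2 = i
        · subst h1
          rw [if_pos rfl, if_neg hi'.symm, ← Finset.mul_prod_erase _ _ (Finset.mem_univ j),
            ← Finset.mul_prod_erase _ (fun j2 => x (i2, j2)) (Finset.mem_univ j), if_pos rfl,
            Finset.prod_congr rfl (g := fun j2 => x (i2, j2)), ← hc]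
          · ring
          · intro j2 h2
            rw [if_neg, if_neg]
            · ring
            · intro h; exact hi' (congrArg Prod.fst h).symm
            · intro h; exact (Finset.ne_of_mem_erase h2) (congrArg Prod.snd h)
        · by_cases h3 : i2 = i'
          · subst h3
            rw [if_neg h1, if_pos rfl, ← Finset.mul_prod_erase _ _ (Finset.mem_univ j'),
              ← Finset.mul_prod_erase _ (fun j2 => x (i2, j2)) (Finset.mem_univ j'),
              if_neg (fun h => h1 (congrArg Prod.fst h)), if_pos rfl,
              Finset.prod_congr rfl (g := fun j2 => x (i2, j2)), ← hc']
            · ring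
            · intro j2 h2
              rw [if_neg, if_neg]
              · ring
              · intro h; exact (Finset.ne_of_mem_erase h2) (congrArg Prod.snd h)
              · intro h; exact h1 (congrArg Prod.fst h)
          · rw [if_neg h1, if_neg h3, add_zero, add_zero]
            refine Finset.prod_congr rfl fun j2 _ => ?_
            rw [if_neg, if_neg]
            · ring
            · intro h; exact h3 (congrArg Prod.fst h)
            · intro h; exact h1 (congrArg Prod.fst h)
      have hx0 : ∑ i, ∏ j, x (i, j) = 0 := hx
      simp only [XX, Set.mem_ofPred_eq, e, Finset.sum_add_distrib, Finset.sum_ite_eq',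
        Finset.mem_univ, if_true, hx0]
      ring
    · intro q hq hxq
      rw [if_neg, if_neg]
      · rintro rfl; exact hxq (hj'' hq)
      · rintro rfl; exact hxq hxp

lemma hom_rel {f : (Fin m × Fin d → K) → K} {s : (Fin m → Fin d) → ℕ}
    (hs : ∀ J, Hom f J (s J)) {z : Fin m × Fin d → K} (hz : z ∈ XX K m d) (hfz : f z ≠ 0)
    (J1 J2 L1 L2 : Fin m → Fin d)
    (h : ∀ i, (J1 i = L1 i ∧ J2 i = L2 i) ∨ (J1 i = L2 i ∧ J2 i = L1 i)) (t : K) :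
    t ^ (s J1 + s J2) = t ^ (s L1 + s L2) := by
  have e : scl J1 t (scl J2 t z) = scl L1 t (scl L2 t z) := by
    funext p
    simp only [scl]
    rcases h p.1 with ⟨h1, h2⟩ | ⟨h1, h2⟩
    · rw [h1, h2]
    · rw [h1, h2]; split_ifs <;> rfl
  have := congrArg f e
  rw [hs _ _ (scl_mem _ _ hz), hs _ _ hz, hs _ _ (scl_mem _ _ hz), hs _ _ hz, ← mul_assoc,
    ← mul_assoc, ← pow_add, ← pow_add] at this
  exact mul_right_cancel₀ hfz this

lemma line_deg {f : (Fin m × Fin d → K) → K} {a : ℕ} (hf : LP (XX K m d) f a)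
    (S : Finset K) (haS : a < S.card) (T : Fin m × Fin d → Prop) [DecidablePred T]
    {z : Fin m × Fin d → K} (hfz : f z ≠ 0) (N : ℕ) (hN : N < S.card)
    (hX : ∀ t : K, (fun p => if T p then t * z p else z p) ∈ XX K m d)
    (hfN : ∀ t : K, f (fun p => if T p then t * z p else z p) = t ^ N * f z) : N ≤ a := by
  have e : ∀ t : K, (fun p => if T p then t * z p else z p) =
      fun p => (if T p then 0 else z p) + t * (if T p then z p else 0) := by
    intro t; funext p; split_ifs <;> simp
  obtain ⟨q, h1, h2⟩ := hf (fun p => if T p then 0 else z p) (fun p => if T p then z p else 0)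
    (by intro t; rw [← e]; exact hX t)
  refine pow_deg S a N hN haS (f z) hfz q h1 ?_
  intro t
  rw [← h2, ← e, hfN, mul_comm]

lemma two_disj {f : (Fin m × Fin d → K) → K} {a : ℕ} (hf : LP (XX K m d) f a)
    {s : (Fin m → Fin d) → ℕ} (hs : ∀ J, Hom f J (s J)) (hsa : ∀ J, s J ≤ a)
    (S : Finset K) (haS : 2 * a < S.card)
    {z : Fin m × Fin d → K} (hz : z ∈ XX K m d) (hfz : f z ≠ 0)
    (J1 J2 : Fin m → Fin d) (h : ∀ i, J1 i ≠ J2 i) : s J1 + s J2 ≤ a := by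
  have e : ∀ t : K, (fun p : Fin m × Fin d => if J1 p.1 = p.2 ∨ J2 p.1 = p.2 then t * z p else z p)
      = scl J1 t (scl J2 t z) := by
    intro t; funext p; simp only [scl]
    have := h p.1
    by_cases h1 : J1 p.1 = p.2
    · have h2 : J2 p.1 ≠ p.2 := fun h => this (h1.trans h.symm)
      simp [h1, h2]
    · simp [h1]
  refine line_deg hf S (by omega) (fun p => J1 p.1 = p.2 ∨ J2 p.1 = p.2) hfz _ ?_ ?_ ?_
  · have := hsa J1; have := hsa J2; omega
  · intro t; rw [e]; exact scl_mem _ _ (scl_mem _ _ hz)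
  · intro t; rw [e, hs _ _ (scl_mem _ _ hz), hs _ _ hz, pow_add, mul_assoc]

/-- sum of weights over a family of translates -/
lemma sum_disj [NeZero d] {f : (Fin m × Fin d → K) → K} {a : ℕ} (hf : LP (XX K m d) f a)
    {s : (Fin m → Fin d) → ℕ} (hs : ∀ J, Hom f J (s J)) (hsa : ∀ J, s J ≤ a)
    (S : Finset K) (haS : a * d < S.card)
    {z : Fin m × Fin d → K} (hz : z ∈ XX K m d) (hfz : f z ≠ 0)
    (J : Fin m → Fin d) : ∑ c : Fin d, s (fun i => J i + c) ≤ a := by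
  have hd : 0 < d := Nat.pos_of_ne_zero (NeZero.ne d)
  have e : ∀ (t : K) (T : Finset (Fin d)),
      (fun p : Fin m × Fin d => if p.2 - J p.1 ∈ T then t * z p else z p) ∈ XX K m d ∧
      f (fun p => if p.2 - J p.1 ∈ T then t * z p else z p) =
        t ^ (∑ c ∈ T, s (fun i => J i + c)) * f z := by
    intro t T
    induction T using Finset.induction_on with
    | empty => simpa using hz
    | insert c T hc ih =>
      have e : (fun p : Fin m × Fin d => if p.2 - J p.1 ∈ insert c T then t * z p else z p) =
          scl (fun i => J i + c) t (fun p => if p.2 - J p.1 ∈ T then t * z p else z p) := by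
        funext p
        simp only [scl]
        by_cases h : J p.1 + c = p.2
        · have : p.2 - J p.1 = c := by rw [← h]; abel
          rw [if_pos h, this, if_pos (Finset.mem_insert_self _ _), if_neg hc]
        · have : p.2 - J p.1 ≠ c := by rintro rfl; apply h; abel
          rw [if_neg h]
          simp [Finset.mem_insert, this]
      rw [e]
      refine ⟨scl_mem _ _ ih.1, ?_⟩
      rw [hs _ _ ih.1, ih.2, Finset.sum_insert hc, pow_add, mul_assoc]
  refine line_deg hf S ?_ (fun p : Fin m × Fin d => p.2 - J p.1 ∈ (Finset.univ : Finset (Fin d)))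
    hfz _ ?_ ?_ ?_
  · exact lt_of_le_of_lt (Nat.le_mul_of_pos_right a hd) haS
  · refine lt_of_le_of_lt ?_ haS
    refine (Finset.sum_le_card_nsmul _ _ a fun c _ => hsa _).trans ?_
    simp [mul_comm]
  · intro t; exact (e t Finset.univ).1
  · intro t; exact (e t Finset.univ).2

end


section
variable {K : Type*} [Field K] {m d : ℕ}

lemma chart' {f : (Fin m × Fin d → K) → K} {s : (Fin m → Fin d) → ℕ}
    (hs : ∀ J, Hom f J (s J)) (J : Fin m → Fin d) (hJ : ∀ J', s J ≤ s J')
    {x : Fin m × Fin d → K} (hx : x ∈ XX K m d) (hU : InU J x) :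
      f x = (∏ p, x p ^ (s (Function.update J p.1 p.2) - s J)) *
        f (sig J fun i => ∏ j, x (i, j)) :=
  chart hs J hJ _ x hx hU rfl

lemma sig_line {f : (Fin m × Fin d → K) → K} {a : ℕ} (hf : LP (XX K m d) f a)
    (M : Fin m → Fin d) (y0 y1 : Fin m → K) (h0 : ∑ i, y0 i = 0) (h1 : ∑ i, y1 i = 0) :
    ∃ q : Polynomial K, q.natDegree ≤ a ∧ ∀ t, f (sig M fun i => y0 i + t * y1 i) = q.eval t := by
  have e : ∀ t, sig M (fun i => y0 i + t * y1 i) =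
      fun p => sig M y0 p + t * (if M p.1 = p.2 then y1 p.1 else 0) := by
    intro t; funext p; simp only [sig]; split_ifs <;> simp
  obtain ⟨q, h2, h3⟩ := hf (sig M y0) (fun p => if M p.1 = p.2 then y1 p.1 else 0) (by
    intro t; rw [← e]; apply sig_mem
    rw [Finset.sum_add_distrib, ← Finset.mul_sum, h0, h1]; simp)
  exact ⟨q, h2, fun t => by rw [e, h3]⟩

/-- The exceptional configuration of weights cannot occur. -/
lemma no_bad {f : (Fin m × Fin d → K) → K} {a : ℕ} (hf : LP (XX K m d) f a)
    {s : (Fin m → Fin d) → ℕ} (hs : ∀ J, Hom f J (s J)) (hsa : ∀ J, s J ≤ a)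
    (S : Finset K) (h0S : (0 : K) ∉ S) (haS : 2 * a ≤ S.card) (ha : 1 ≤ a)
    (J : Fin m → Fin d) (hk : s J = 0)
    {z : Fin m × Fin d → K} (hz : z ∈ XX K m d) (hzU : InU J z) (hfz : f z ≠ 0)
    (L : Fin m → Fin d)
    (l i h : Fin m) (hli : l ≠ i) (hlh : l ≠ h) (hih : i ≠ h)
    (hl : 1 ≤ s (Function.update J l (L l))) (hi : s (Function.update J i (L i)) = a) : False := by
  classical
  have hJ : ∀ J', s J ≤ s J' := by intro J'; omega
  set R := s (Function.update J l (L l)) with hR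
  have hRa : R ≤ a := hsa _
  set c := f (sig J 0) with hcdef
  have hconst : ∀ y : Fin m → K, ∑ i, y i = 0 → f (sig J y) = c := by
    intro y hy
    have := hs J _ (sig_mem J hy) 0
    rw [hk, pow_zero, one_mul] at this
    rw [← this, hcdef]
    congr 1
    funext p; simp only [scl, sig]; split_ifs <;> simp
  have hc : c ≠ 0 := by
    intro h
    apply hfz
    rw [chart' hs J hJ hz hzU, hconst _ hz, h, mul_zero]
  let M := Function.update (Function.update J l (L l)) i (L i)
  let y : K → K → Fin m → K := fun u v n =>
    if n = l then u else if n = i then v else if n = h then - u - v else 0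
  have hy : ∀ u v, ∑ n, y u v n = 0 := by
    intro u v
    have : ∀ n, y u v n = (if n = l then u else 0) + (if n = i then v else 0) +
        (if n = h then -u - v else 0) := by
      intro n
      simp only [y]
      by_cases h1 : n = l
      · subst h1; simp [hli, hlh]
      · by_cases h2 : n = i
        · subst h2; simp [h1, hih]
        · simp [h1, h2]
    simp [this, Finset.sum_add_distrib]
  have hMl : M l = L l := by simp [M, Function.update_of_ne hli]
  have hMi : M i = L i := by simp [M]
  have hMo : ∀ n, n ≠ l → n ≠ i → M n = J n := by
    intro n h1 h2; simp [M, Function.update_of_ne h1, Function.update_of_ne h2]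
  have form : ∀ u v, u ≠ 0 → v ≠ 0 → f (sig M (y u v)) = u ^ R * v ^ a * c := by
    intro u v hu hv
    rw [chart' hs J hJ (sig_mem M (hy u v))]
    · simp only [sig_prod]
      rw [hconst _ (hy u v)]
      congr 1
      rw [Fintype.prod_prod_type]
      have e : ∀ n, ∏ j, sig M (y u v) (n, j) ^ (s (Function.update J n j) - s J) =
          y u v n ^ (s (Function.update J n (M n)) - s J) := by
        intro n
        rw [Finset.prod_eq_single (M n)]
        · simp [sig]
        · intro j _ hj; simp [sig, hj.symm]
        · simp
      simp only [e]
      rw [Finset.prod_eq_mul l i hli]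
      · rw [hMl, hMi, hi, hk, ← hR]; simp [y, hli.symm]
      · intro n _ hn
        rw [hMo n hn.1 hn.2]; simp
      · simp
      · simp
    · intro p hp
      simp only [sig]
      split_ifs with h1
      · by_cases h2 : p.1 = l
        · simp [y, h2, hu]
        · by_cases h3 : p.1 = i
          · simp [y, h3, hli.symm, hv]
          · exfalso; apply hp; rw [← h1, hMo _ h2 h3]
      · exact one_ne_zero
  have haS' : a < S.card := by omega
  -- extend to `u = 0`
  have form2 : ∀ u v, v ≠ 0 → f (sig M (y u v)) = u ^ R * v ^ a * c := by
    intro u v hv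
    obtain ⟨q, h1, h2⟩ := sig_line hf M (y 0 v) (y 1 0) (hy _ _) (hy _ _)
    have e : ∀ u, (fun n => y 0 v n + u * y 1 0 n) = y u v := by
      intro u; funext n; simp only [y]; split_ifs <;> ring
    simp only [e] at h2
    have := poly_eq S a haS' q (Polynomial.C (v ^ a * c) * Polynomial.X ^ R) h1
      ((Polynomial.natDegree_C_mul_X_pow_le _ _).trans hRa) (by
        intro t ht
        rw [← h2, form t v (fun h => h0S (h ▸ ht)) hv]
        simp; ring)
    rw [h2, this]
    simp; ring
  have form3 : ∀ u v, f (sig M (y u v)) = u ^ R * v ^ a * c := by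
    intro u v
    obtain ⟨q, h1, h2⟩ := sig_line hf M (y u 0) (y 0 1) (hy _ _) (hy _ _)
    have e : ∀ v, (fun n => y u 0 n + v * y 0 1 n) = y u v := by
      intro u; funext n; simp only [y]; split_ifs <;> ring
    simp only [e] at h2
    have := poly_eq S a haS' q (Polynomial.C (u ^ R * c) * Polynomial.X ^ a) h1
      (Polynomial.natDegree_C_mul_X_pow_le _ _) (by
        intro t ht
        rw [← h2, form2 u t (fun h => h0S (h ▸ ht))]
        simp; ring)
    rw [h2, this]
    simp; ring
  obtain ⟨q, h1, h2⟩ := sig_line hf M (y 0 0) (y 1 1) (hy _ _) (hy _ _)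
  have e : ∀ v, (fun n => y 0 0 n + v * y 1 1 n) = y v v := by
    intro u; funext n; simp only [y]; split_ifs <;> ring
  simp only [e] at h2
  have hcard : (insert (0 : K) S).card = S.card + 1 := Finset.card_insert_of_notMem h0S
  have := pow_deg (insert (0 : K) S) a (R + a) (by omega) (by omega) c hc q h1 (by
    intro t; rw [← h2, form3]; ring)
  omega

lemma weights {f : (Fin m × Fin d → K) → K} {a : ℕ} (hf : LP (XX K m d) f a)
    {s : (Fin m → Fin d) → ℕ} (hs : ∀ J, Hom f J (s J)) (hsa : ∀ J, s J ≤ a)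
    (S : Finset K) (h0S : (0 : K) ∉ S) (haS : 2 * a ≤ S.card) (ha : 1 ≤ a)
    {ζ : K} {e : ℕ} (he : 2 * a ≤ e) (hζ : IsPrimitiveRoot ζ e)
    (J : Fin m → Fin d) (hJ : ∀ J', s J ≤ s J')
    {z : Fin m × Fin d → K} (hz : z ∈ XX K m d) (hzU : InU J z) (hfz : f z ≠ 0)
    (L : Fin m → Fin d) (hL : ∀ i, L i ≠ J i) (T : Finset (Fin m)) :
    s (T.piecewise L J) = s J + ∑ i ∈ T, (s (Function.update J i (L i)) - s J) := by
  classical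
  induction T using Finset.induction_on with
  | empty => simp
  | insert i T hi ih =>
    rw [Finset.sum_insert hi]
    have hrel := hom_rel hs hz hfz ((insert i T).piecewise L J) J (T.piecewise L J)
      (Function.update J i (L i)) (by
        intro n
        by_cases hn : n = i
        · subst hn; right; simp [hi]
        · left; simp [Finset.piecewise, hn]) ζ
    set A := s ((insert i T).piecewise L J) with hA
    set B := s (T.piecewise L J) with hB
    set D := s (Function.update J i (L i)) with hD
    have hA1 := hsa ((insert i T).piecewise L J)
    have hB1 := hsa (T.piecewise L J)
    have hD1 := hsa (Function.update J i (L i))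
    have hA2 := hJ ((insert i T).piecewise L J)
    have hB2 := hJ (T.piecewise L J)
    have hD2 := hJ (Function.update J i (L i))
    rw [← hA] at hA1 hA2
    rw [← hB] at hB1 hB2
    rw [← hD] at hD1 hD2
    have hk1 := hsa J
    suffices A + s J = B + D by omega
    by_contra hne
    have hbad : A = 0 ∧ s J = 0 ∧ B = a ∧ D = a := by
      by_cases c1 : A + s J < e
      · by_cases c2 : B + D < e
        · exact absurd (hζ.pow_inj c1 c2 hrel) hne
        · have hBD : B + D = e := by omega
          rw [hBD, hζ.pow_eq_one, ← pow_zero ζ] at hrel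
          have := hζ.pow_inj c1 (by omega) hrel
          omega
      · omega
    obtain ⟨b1, b2, b3, b4⟩ := hbad
    by_cases huniv : insert i T = Finset.univ
    · have := two_disj hf hs hsa (insert 0 S) (by
        rw [Finset.card_insert_of_notMem h0S]; omega) hz hfz (T.piecewise L J)
        (Function.update J i (L i)) (by
          intro n
          by_cases hn : n = i
          · subst hn; simpa [hi] using (hL n).symm
          · have : n ∈ T := by
              have : n ∈ insert i T := huniv ▸ Finset.mem_univ n
              simpa [hn] using this
            simpa [hn, this] using hL n)
      omega
    · obtain ⟨h, hh⟩ : ∃ h, h ∉ insert i T := by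
        by_contra hcon; push Not at hcon
        exact huniv (Finset.eq_univ_iff_forall.2 hcon)
      simp only [Finset.mem_insert, not_or] at hh
      obtain ⟨l, hl, hl2⟩ : ∃ l ∈ T, s (Function.update J l (L l)) - s J ≠ 0 := by
        by_contra hcon; push Not at hcon
        rw [Finset.sum_eq_zero hcon] at ih
        omega
      exact no_bad hf hs hsa S h0S haS ha J b2 hz hzU hfz L l i h
        (fun e => hi (e ▸ hl)) (fun e => hh.2 (e ▸ hl)) (fun e => hh.1 e.symm) (by omega) b4

lemma total [NeZero d] {f : (Fin m × Fin d → K) → K} {a : ℕ} (hf : LP (XX K m d) f a)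
    {s : (Fin m → Fin d) → ℕ} (hs : ∀ J, Hom f J (s J)) (hsa : ∀ J, s J ≤ a)
    (S : Finset K) (h0S : (0 : K) ∉ S) (haS : a * d ≤ S.card) (ha : 1 ≤ a) (hd : 2 ≤ d)
    {ζ : K} (hζ : IsPrimitiveRoot ζ (a * d))
    (J : Fin m → Fin d) (hJ : ∀ J', s J ≤ s J')
    {z : Fin m × Fin d → K} (hz : z ∈ XX K m d) (hzU : InU J z) (hfz : f z ≠ 0) :
    ∑ p : Fin m × Fin d, (s (Function.update J p.1 p.2) - s J) + d * s J ≤ a := by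
  classical
  have h2 : 2 * a ≤ a * d := by nlinarith
  have h1 := sum_disj hf hs hsa (insert 0 S) (by
        rw [Finset.card_insert_of_notMem h0S]; omega) hz hfz J
  have h3 : ∀ c : Fin d, s (fun i => J i + c) =
      s J + ∑ i, (s (Function.update J i (J i + c)) - s J) := by
    intro c
    by_cases hc : c = 0
    · subst hc; simp
    · have := weights hf hs hsa S h0S (by omega) ha h2 hζ J hJ hz hzU hfz (fun i => J i + c)
        (by intro i; simpa using hc) Finset.univ
      simpa using this
  simp only [h3, Finset.sum_add_distrib, Finset.sum_const, Finset.card_univ, Fintype.card_fin,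
    smul_eq_mul] at h1
  rw [Finset.sum_comm] at h1
  rw [Fintype.sum_prod_type, add_comm]
  refine le_trans (le_of_eq ?_) h1
  congr 1
  refine Finset.sum_congr rfl fun i _ => ?_
  exact (Equiv.sum_comp (Equiv.addLeft (J i))
    (fun j => s (Function.update J i j) - s J)).symm

lemma ext_hom [NeZero d] {f : (Fin m × Fin d → K) → K} {a : ℕ} (hf : WP (XX K m d) f a)
    {s : (Fin m → Fin d) → ℕ} (hs : ∀ J, Hom f J (s J)) (hsa : ∀ J, s J ≤ a)
    (S : Finset K) (h0S : (0 : K) ∉ S) (haS : a * d ≤ S.card) (ha : 1 ≤ a) (hd : 2 ≤ d)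
    (hm : 1 ≤ m) {ζ : K} (hζ : IsPrimitiveRoot ζ (a * d)) : ExtP (XX K m d) f a := by
  classical
  have h2 : 2 * a ≤ a * d := by nlinarith
  have haS' : a < S.card := by omega
  obtain ⟨J, hJ⟩ := Finite.exists_min s
  -- a polynomial agreeing with `f` on the chart
  obtain ⟨g, hg, hfg, hgJ⟩ : ∃ g : MvPolynomial (Fin m × Fin d) K, g.totalDegree ≤ a ∧
      (∀ x ∈ XX K m d, InU J x → f x = eval x g) ∧
      (m = 1 → ∀ x ∈ XX K m d, eval (scl J 0 x) g = eval x g) := by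
    by_cases hz : ∃ z ∈ XX K m d, InU J z ∧ f z ≠ 0
    · obtain ⟨z, hz, hzU, hfz⟩ := hz
      have htot := total hf.lp hs hsa S h0S haS ha hd hζ J hJ hz hzU hfz
      obtain ⟨P, hP, hfP⟩ := sig_poly hf S haS' J (s J) (hsa J) (hs J)
      have hev : ∀ x : Fin m × Fin d → K, eval x
          ((∏ p, X p ^ (s (Function.update J p.1 p.2) - s J)) *
          aeval (fun i => ∏ j, (X (i, j) : MvPolynomial (Fin m × Fin d) K)) P) =
          (∏ p, x p ^ (s (Function.update J p.1 p.2) - s J)) *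
            eval (fun i => ∏ j, x (i, j)) P := by
        intro x
        rw [map_mul, map_prod]
        simp only [map_pow, eval_X]
        congr 1
        rw [← RingHom.coe_coe (aeval _), ← RingHom.comp_apply]
        congr 1
        apply MvPolynomial.ringHom_ext
        · intros; simp
        · intro p; simp
      refine ⟨(∏ p, X p ^ (s (Function.update J p.1 p.2) - s J)) *
          aeval (fun i => ∏ j, (X (i, j) : MvPolynomial (Fin m × Fin d) K)) P, ?_, ?_, ?_⟩
      · refine (totalDegree_mul _ _).trans (le_trans (add_le_add ?_ ?_) htot)
        · refine (totalDegree_finsetProd _ _).trans (Finset.sum_le_sum fun p _ => ?_)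
          rw [totalDegree_X_pow]
        · refine (IsHomogeneous.totalDegree_le (n := d * s J) ?_)
          refine hP.aeval _ (fun i => ?_)
          have := IsHomogeneous.prod Finset.univ
            (fun j => (X (i, j) : MvPolynomial (Fin m × Fin d) K)) (fun _ => 1)
            (fun j _ => isHomogeneous_X _ _)
          simpa using this
      · intro x hx hU
        rw [hev, chart' hs J hJ hx hU, hfP _ hx]
      · intro hm1 x hx
        subst hm1
        rw [hev, hev]
        congr 1
        · refine Finset.prod_congr rfl fun p _ => ?_
          simp only [scl]
          split_ifs with h
          · rw [← h]; simp
          · rfl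
        · have hy : ∀ x ∈ XX K 1 d, (fun i => ∏ j, x (i, j)) = (0 : Fin 1 → K) := by
            intro x hx
            funext i
            have : ∑ i, ∏ j, x (i, j) = 0 := hx
            rw [Fin.sum_univ_one] at this
            rw [Subsingleton.elim i 0]; exact this
          rw [hy x hx, hy _ (scl_mem _ _ hx)]
    · push Not at hz
      exact ⟨0, by simp, fun x hx hU => by simp [hz x hx hU], by simp⟩
  have hF := (hf.sub_poly g hg).lp
  have hFU : ∀ x ∈ XX K m d, InU J x → f x - eval x g = 0 := fun x hx hU => by
    rw [hfg x hx hU, sub_self]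
  by_cases hm2 : 2 ≤ m
  · exact ⟨g, hg, fun x hx =>
      sub_eq_zero.1 (spread hF S haS' h0S J hFU _ x hx rfl (Or.inl hm2))⟩
  · have hm1 : m = 1 := by omega
    subst hm1
    by_cases hk : s J = 0
    · refine ⟨g, hg, fun x hx => ?_⟩
      have h3 := spread hF S haS' h0S J hFU _ (scl J 0 x) (scl_mem _ _ hx) rfl
        (Or.inr fun i => by simp [scl])
      rw [hgJ rfl x hx, hs J x hx, hk, pow_zero, one_mul] at h3
      exact sub_eq_zero.1 h3
    · refine ⟨0, by simp, fun x hx => ?_⟩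
      have h3 : ∑ i, ∏ j, x (i, j) = 0 := hx
      rw [Fin.sum_univ_one, Finset.prod_eq_zero_iff] at h3
      obtain ⟨j, _, hj⟩ := h3
      have h4 : scl (fun _ => j) 0 x = x := by
        funext p
        obtain ⟨i, j'⟩ := p
        rw [Subsingleton.elim i 0]
        simp only [scl]
        split_ifs with h
        · rw [← h, hj, mul_zero]
        · rfl
      have h5 := hs (fun _ => j) x hx 0
      have h6 := hJ (fun _ => j)
      rw [h4, zero_pow (by omega), zero_mul] at h5
      rw [h5, map_zero]

lemma main_thm (d m a : ℕ) (hd : 1 ≤ d) (hm : 1 ≤ m) (ha : 1 ≤ a)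
    (hadm : ∃ ζ : K, IsPrimitiveRoot ζ (a * d)) (f : (Fin m × Fin d → K) → K)
    (hf : WP (XX K m d) f a) : ExtP (XX K m d) f a := by
  classical
  obtain ⟨ζ, hζ⟩ := hadm
  by_cases hd1 : d = 1
  · subst hd1
    let H : Submodule K (Fin m × Fin 1 → K) := LinearMap.ker
      (∑ i : Fin m, (LinearMap.proj (i, (0 : Fin 1)) : (Fin m × Fin 1 → K) →ₗ[K] K))
    have hH : ∀ y, y ∈ H ↔ y ∈ XX K m 1 := by
      intro y; simp [H, LinearMap.mem_ker, XX]
    obtain ⟨g, hg, h⟩ := hf H.toAffineSubspace (fun y hy => (hH y).1 hy)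
    exact ⟨g, hg, fun x hx => h x ((hH x).2 hx)⟩
  · haveI : NeZero d := ⟨by omega⟩
    let S : Finset K := (Finset.range (a * d)).image (fun n => ζ ^ n)
    have hpos : 0 < a * d := Nat.mul_pos ha hd
    have hS : S.card = a * d := by
      rw [Finset.card_image_of_injOn, Finset.card_range]
      intro i hi j hj h
      exact hζ.pow_inj (by simpa using hi) (by simpa using hj) h
    have h0S : (0 : K) ∉ S := by
      simp only [S, Finset.mem_image, not_exists, not_and]
      intro n _ h
      exact pow_ne_zero n (hζ.ne_zero hpos.ne') h
    have h2 : 2 * a ≤ a * d := by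
      have : 2 ≤ d := by omega
      nlinarith
    refine decomp S (by omega) ?_ f hf
    intro f hf h
    choose s hsa hs using h
    exact ext_hom hf hs hsa S h0S hS.ge ha (by omega) hm hζ
end

/-- Fix `d ≥ 1`, `m ≥ 1`, `a ≥ 1` and let `K` be an `ad`-admissible field
(`K*` contains the group of roots of unity of order `ad`, i.e. `K` has a primitive
`ad`-th root of unity). Let `W = K^d`, `μ : W → K` the product of coordinates,
`V_m = W^m`, `Q_m(w_1,...,w_m) = ∑_{i=1}^m μ(w_i)` and `X_m = Q_m⁻¹(0) ⊆ V_m`.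
Then `X_m` satisfies condition `⋆_a`. -/
theorem stmt11 (K : Type*) [Field K] (d m a : ℕ) (hd : 1 ≤ d) (hm : 1 ≤ m) (ha : 1 ≤ a)
    (hadm : ∃ ζ : K, IsPrimitiveRoot ζ (a * d)) :
    StarCondition
      {x : Fin m × Fin d → K |
        eval x (∑ i : Fin m, ∏ j : Fin d, (X (i, j) : MvPolynomial (Fin m × Fin d) K)) = 0}
      a := by
  have hX : {x : Fin m × Fin d → K |
        eval x (∑ i : Fin m, ∏ j : Fin d, (X (i, j) : MvPolynomial (Fin m × Fin d) K)) = 0} =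
      XX K m d := by
    ext x
    simp [XX, map_sum, map_prod]
  rw [hX]
  intro f hf
  exact main_thm d m a hd hm ha hadm f hf
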